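/- arXiv:1202.1156 — 5 statements merged into one kernel-verified Lean document; each statement's English description precedes it below -/
import Mathlib

section
/- For every positive integer n, the number of triangles with integer sides and perimeter n (i.e., the number of triples (x, y, z) of positive integers with x ≥ y ≥ z, x + y + z = n, and y + z > x) equals {n²/12} − ⌊n/4⌋·⌊(n+2)/4⌋, where {r} denotes the integer nearest to the rational number r (which is well-defined here since n²/12 is never a half-integer). -/
/-- Triangles of perimeter `n`, counted by their longest side `x` and middle side `y`. -/
theorem card_triangles_eq_sum (n : ℕ) :
    Nat.card {p : ℕ × ℕ × ℕ //
        0 < p.2.2 ∧ p.2.2 ≤ p.2.1 ∧ p.2.1 ≤ p.1 ∧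
        p.1 + p.2.1 + p.2.2 = n ∧ p.1 < p.2.1 + p.2.2}
      = ∑ x ∈ Finset.Ico ((n + 2) / 3) ((n + 1) / 2), (x + 1 - (n - x + 1) / 2) := by
  let s := (Finset.Ico ((n + 2) / 3) ((n + 1) / 2)).sigma
    fun x => Finset.Icc ((n - x + 1) / 2) x
  have e : {p : ℕ × ℕ × ℕ //
        0 < p.2.2 ∧ p.2.2 ≤ p.2.1 ∧ p.2.1 ≤ p.1 ∧
        p.1 + p.2.1 + p.2.2 = n ∧ p.1 < p.2.1 + p.2.2} ≃ s :=
    { toFun := fun p => ⟨⟨p.1.1, p.1.2.1⟩, by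
        obtain ⟨⟨x, y, z⟩, h⟩ := p
        simp only [s, Finset.mem_sigma, Finset.mem_Ico, Finset.mem_Icc] at h ⊢
        omega⟩
      invFun := fun q => ⟨(q.1.1, q.1.2, n - q.1.1 - q.1.2), by
        obtain ⟨⟨x, y⟩, h⟩ := q
        simp only [s, Finset.mem_sigma, Finset.mem_Ico, Finset.mem_Icc] at h ⊢
        omega⟩
      left_inv := by
        rintro ⟨⟨x, y, z⟩, h⟩
        simp only [Subtype.mk.injEq, Prod.mk.injEq, true_and] at h ⊢
        omega
      right_inv := fun _ => rfl }
  rw [Nat.card_congr e, Nat.card_eq_fintype_card, Fintype.card_coe, Finset.card_sigma]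
  simp

theorem sum_triangles_add_six (n : ℕ) :
    ∑ x ∈ Finset.Ico ((n + 6 + 2) / 3) ((n + 6 + 1) / 2), (x + 1 - (n + 6 - x + 1) / 2)
      = ∑ x ∈ Finset.Ico ((n + 2) / 3) ((n + 1) / 2), (x + 1 - (n - x + 1) / 2)
        + ((n + 1) / 2 + 1 - (n - (n + 1) / 2 + 1) / 2) := by
  have h₁ : (n + 6 + 2) / 3 = (n + 2) / 3 + 2 := by omega
  have h₂ : (n + 6 + 1) / 2 = (n + 1) / 2 + 1 + 2 := by omega
  rw [h₁, h₂, ← Finset.sum_Ico_add', Finset.sum_Ico_succ_top (by omega)]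
  congr 1
  · refine Finset.sum_congr rfl fun x hx => ?_
    rw [Finset.mem_Ico] at hx
    omega
  · omega

theorem triangle_formula_add_six (n : ℕ) :
    (((n + 6 : ℕ) : ℤ) ^ 2 + 6) / 12 - ((n + 6 : ℕ) : ℤ) / 4 * ((((n + 6 : ℕ) : ℤ) + 2) / 4)
      = ((n : ℤ) ^ 2 + 6) / 12 - (n : ℤ) / 4 * (((n : ℤ) + 2) / 4)
        + (((n + 1) / 2 + 1 - (n - (n + 1) / 2 + 1) / 2 : ℕ) : ℤ) := by
  obtain ⟨q, r, hr, rfl⟩ : ∃ q r, r < 4 ∧ n = 4 * q + r :=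
    ⟨n / 4, n % 4, Nat.mod_lt _ (by norm_num), by omega⟩
  have hsq : (((4 * q + r + 6 : ℕ) : ℤ) ^ 2 + 6) / 12
      = (((4 * q + r : ℕ) : ℤ) ^ 2 + 6) / 12 + (4 * q + r + 3) := by
    rw [← Int.add_mul_ediv_right _ _ (by norm_num)]
    congr 1
    push_cast
    ring
  have hg : (4 * q + r + 1) / 2 + 1 - (4 * q + r - (4 * q + r + 1) / 2 + 1) / 2
      = q + 1 + (r + 1) / 2 - (r / 2 + 1) / 2 := by omega
  have h₁ : ((4 * q + r + 6 : ℕ) : ℤ) / 4 = q + 1 + (r + 2) / 4 := by omega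
  have h₂ : (((4 * q + r + 6 : ℕ) : ℤ) + 2) / 4 = q + 2 + r / 4 := by omega
  have h₃ : ((4 * q + r : ℕ) : ℤ) / 4 = q + r / 4 := by omega
  have h₄ : (((4 * q + r : ℕ) : ℤ) + 2) / 4 = q + (r + 2) / 4 := by omega
  rw [hsq, hg, h₁, h₂, h₃, h₄]
  interval_cases r <;> norm_num <;> ring

theorem sum_triangles_eq (n : ℕ) :
    ((∑ x ∈ Finset.Ico ((n + 2) / 3) ((n + 1) / 2), (x + 1 - (n - x + 1) / 2) : ℕ) : ℤ)
      = ((n : ℤ) ^ 2 + 6) / 12 - (n : ℤ) / 4 * (((n : ℤ) + 2) / 4) := by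
  induction n using Nat.strong_induction_on with
  | _ n ih =>
    by_cases hn : n < 6
    · interval_cases n <;> decide
    · obtain ⟨m, rfl⟩ := Nat.exists_eq_add_of_le' (not_lt.mp hn)
      rw [sum_triangles_add_six, triangle_formula_add_six, Nat.cast_add, ih m (by omega)]

theorem round_intCast_div_twelve (a : ℤ) : round ((a : ℚ) / 12) = (a + 6) / 12 := by
  have h : (a : ℚ) / 12 + 1 / 2 = ((a + 6 : ℤ) : ℚ) / (12 : ℕ) := by
    push_cast
    ring
  rw [round_eq, h, Rat.floor_intCast_div_natCast]
  rfl

theorem triangle_count_formula (n : ℕ) (hn : 0 < n) :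
    (Nat.card {p : ℕ × ℕ × ℕ //
        0 < p.2.2 ∧ p.2.2 ≤ p.2.1 ∧ p.2.1 ≤ p.1 ∧
        p.1 + p.2.1 + p.2.2 = n ∧ p.1 < p.2.1 + p.2.2} : ℤ)
      = round ((n : ℚ) ^ 2 / 12) - ⌊(n : ℚ) / 4⌋ * ⌊((n : ℚ) + 2) / 4⌋ := by
  have hround : round ((n : ℚ) ^ 2 / 12) = ((n : ℤ) ^ 2 + 6) / 12 := by
    rw [← round_intCast_div_twelve, Int.cast_pow, Int.cast_natCast]
  have hfloor (a : ℤ) : ⌊(a : ℚ) / 4⌋ = a / 4 := by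
    simpa using Rat.floor_intCast_div_natCast a 4
  have h₁ : ⌊(n : ℚ) / 4⌋ = (n : ℤ) / 4 := by simpa using hfloor n
  have h₂ : ⌊((n : ℚ) + 2) / 4⌋ = ((n : ℤ) + 2) / 4 := by simpa using hfloor (n + 2)
  rw [card_triangles_eq_sum, sum_triangles_eq, hround, h₁, h₂]
end

section
/- For every positive integer n, the number of triples (x, y, z) of positive integers with x ≥ y ≥ z, x + y + z = n, and y + z > x equals the number of triples (a, b, t) of nonnegative integers satisfying 4a + 2b + 3t + 3 = n; explicitly, the map sending (a, b, t) to (2a + b + t + 1, a + b + t + 1, a + t + 1) is a bijection from {(a, b, t) ∈ ℕ³ : 4a + 2b + 3t + 3 = n} onto the set of such triangle triples with perimeter n. -/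
theorem triangle_count_eq_partition_count_and_bijection (n : ℕ) (hn : 0 < n) :
    Nat.card {p : ℕ × ℕ × ℕ //
        0 < p.2.2 ∧ p.2.2 ≤ p.2.1 ∧ p.2.1 ≤ p.1 ∧
        p.1 + p.2.1 + p.2.2 = n ∧ p.1 < p.2.1 + p.2.2}
      = Nat.card {q : ℕ × ℕ × ℕ // 4 * q.1 + 2 * q.2.1 + 3 * q.2.2 + 3 = n} ∧
    Set.BijOn
      (fun q : ℕ × ℕ × ℕ =>
        (2 * q.1 + q.2.1 + q.2.2 + 1, q.1 + q.2.1 + q.2.2 + 1, q.1 + q.2.2 + 1))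
      {q : ℕ × ℕ × ℕ | 4 * q.1 + 2 * q.2.1 + 3 * q.2.2 + 3 = n}
      {p : ℕ × ℕ × ℕ |
        0 < p.2.2 ∧ p.2.2 ≤ p.2.1 ∧ p.2.1 ≤ p.1 ∧
        p.1 + p.2.1 + p.2.2 = n ∧ p.1 < p.2.1 + p.2.2} := by
  refine (and_iff_right_of_imp fun h => (Nat.card_congr h.equiv).symm).mpr ?_
  refine ⟨?_, ?_, ?_⟩
  · rintro ⟨a, b, t⟩ h
    simp only [Set.mem_ofPred_eq] at h ⊢
    omega
  · rintro ⟨a, b, t⟩ _ ⟨a', b', t'⟩ _ h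
    simp only [Prod.mk.injEq] at h ⊢
    omega
  · rintro ⟨x, y, z⟩ h
    simp only [Set.mem_ofPred_eq] at h
    refine ⟨(x - y, y - z, y + z - x - 1), ?_, ?_⟩
    · simp only [Set.mem_ofPred_eq]
      omega
    · simp only [Prod.mk.injEq]
      omega
end

section
/- The ordinary generating function of the number T(n) of triangles with integer sides and perimeter n equals q³ / ((1 − q²)(1 − q³)(1 − q⁴)); that is, as formal power series, ∑_{n ≥ 0} T(n) qⁿ = q³ · (∑_{a ≥ 0} q^{4a}) · (∑_{t ≥ 0} q^{3t}) · (∑_{b ≥ 0} q^{2b}), equivalently (1 − q²)(1 − q³)(1 − q⁴) · ∑_{n ≥ 0} T(n) qⁿ = q³. -/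
open PowerSeries

/-- The generating function counting the elements of `α` by the weight `w`. -/
noncomputable def weightSeries {α : Type*} (w : α → ℕ) : PowerSeries ℤ :=
  PowerSeries.mk fun n => (Nat.card {a // w a = n} : ℤ)

/-- A pair of weight `n` either has first entry `0` or arises from a pair of weight `n - k`. -/
def weightFiberEquiv {α : Type*} (w : α → ℕ) (k n : ℕ) :
    {p : ℕ × α // k * p.1 + w p.2 = n} ≃
      {a // w a = n} ⊕ {p : ℕ × α // k * p.1 + w p.2 + k = n} where
  toFun
    | ⟨(0, a), h⟩ => .inl ⟨a, by simpa using h⟩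
    | ⟨(i + 1, a), h⟩ => .inr ⟨(i, a), by dsimp only at h ⊢; rw [← h]; ring⟩
  invFun
    | .inl a => ⟨(0, a.1), by simpa using a.2⟩
    | .inr p => ⟨(p.1.1 + 1, p.1.2), by have := p.2; dsimp only; lia⟩
  left_inv := by rintro ⟨⟨_ | i, a⟩, h⟩ <;> rfl
  right_inv := by rintro (a | p) <;> rfl

theorem finite_weight_fiber_prod {α : Type*} {w : α → ℕ} {k : ℕ} (hk : 0 < k)
    (hw : ∀ n, Finite {a // w a = n}) (n : ℕ) :
    Finite {p : ℕ × α // k * p.1 + w p.2 = n} := by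
  induction n using Nat.strong_induction_on with
  | _ n ih =>
    have : Finite {p : ℕ × α // k * p.1 + w p.2 + k = n} := by
      by_cases hn : k ≤ n
      · have := ih (n - k) (by lia)
        exact Finite.of_equiv _ (Equiv.subtypeEquivRight
          (p := fun p : ℕ × α => k * p.1 + w p.2 = n - k) fun p => by lia)
      · have : IsEmpty {p : ℕ × α // k * p.1 + w p.2 + k = n} := ⟨fun p => by have := p.2; lia⟩
        infer_instance
    exact Finite.of_equiv _ (weightFiberEquiv w k n).symm

theorem one_sub_X_pow_mul_weightSeries {α : Type*} {w : α → ℕ} {k : ℕ} (hk : 0 < k)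
    (hw : ∀ n, Finite {a // w a = n}) :
    (1 - PowerSeries.X ^ k) * weightSeries (fun p : ℕ × α => k * p.1 + w p.2) =
      weightSeries w := by
  ext n
  have hfin := finite_weight_fiber_prod hk hw n
  have := Finite.of_equiv _ (weightFiberEquiv w k n)
  have : Finite {p : ℕ × α // k * p.1 + w p.2 + k = n} :=
    Finite.of_injective _ (Sum.inr_injective (α := {a // w a = n}))
  have hcard := Nat.card_congr (weightFiberEquiv w k n)
  rw [Nat.card_sum] at hcard
  simp only [weightSeries, sub_mul, one_mul, map_sub, coeff_X_pow_mul', coeff_mk, hcard]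
  split_ifs with hn
  · have := Nat.card_congr (Equiv.subtypeEquivRight
      (p := fun p : ℕ × α => k * p.1 + w p.2 = n - k)
      (q := fun p => k * p.1 + w p.2 + k = n) fun p => by lia)
    simp [this]
  · have : IsEmpty {p : ℕ × α // k * p.1 + w p.2 + k = n} := ⟨fun p => by have := p.2; lia⟩
    simp

theorem weightSeries_const_unit (m : ℕ) :
    weightSeries (fun _ : Unit => m) = PowerSeries.X ^ m := by
  ext n
  rw [weightSeries, coeff_mk, coeff_X_pow]
  split_ifs with h
  · simp [h]
  · simp [Ne.symm h]

/-- Triangles `x ≥ y ≥ z` in terms of `y - z`, `y + z - x - 1` and `x - y`. -/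
def triangleEquiv (n : ℕ) :
    {p : ℕ × ℕ × ℕ //
        0 < p.2.2 ∧ p.2.2 ≤ p.2.1 ∧ p.2.1 ≤ p.1 ∧
        p.1 + p.2.1 + p.2.2 = n ∧ p.1 < p.2.1 + p.2.2} ≃
      {p : ℕ × ℕ × ℕ × Unit // 2 * p.1 + (3 * p.2.1 + (4 * p.2.2.1 + 3)) = n} where
  toFun p := ⟨(p.1.2.1 - p.1.2.2, p.1.2.1 + p.1.2.2 - p.1.1 - 1, p.1.1 - p.1.2.1, ()), by
    have := p.2; dsimp only; lia⟩
  invFun p := ⟨(p.1.2.1 + 1 + 2 * p.1.2.2.1 + p.1.1, p.1.2.1 + 1 + p.1.2.2.1 + p.1.1,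
    p.1.2.1 + 1 + p.1.2.2.1), by have := p.2; dsimp only; lia⟩
  left_inv := by
    rintro ⟨⟨x, y, z⟩, h⟩
    simp only [Subtype.mk.injEq, Prod.mk.injEq] at h ⊢
    lia
  right_inv := by
    rintro ⟨⟨b, t, a, _⟩, h⟩
    simp only [Subtype.mk.injEq, Prod.mk.injEq, and_true]
    lia

theorem triangle_generating_function :
    (1 - (PowerSeries.X : PowerSeries ℤ) ^ 2) * (1 - PowerSeries.X ^ 3) *
        (1 - PowerSeries.X ^ 4) *
        PowerSeries.mk (fun n =>
          (Nat.card {p : ℕ × ℕ × ℕ //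
              0 < p.2.2 ∧ p.2.2 ≤ p.2.1 ∧ p.2.1 ≤ p.1 ∧
              p.1 + p.2.1 + p.2.2 = n ∧ p.1 < p.2.1 + p.2.2} : ℤ))
      = PowerSeries.X ^ 3 := by
  simp only [fun n => Nat.card_congr (triangleEquiv n)]
  have h₀ : ∀ n, Finite {_u : Unit // 3 = n} := fun n => inferInstance
  have h₁ := finite_weight_fiber_prod (k := 4) (by norm_num) h₀
  have h₂ := finite_weight_fiber_prod (k := 3) (by norm_num) h₁
  calc
    _ = (1 - (PowerSeries.X : PowerSeries ℤ) ^ 4) * ((1 - PowerSeries.X ^ 3) *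
        ((1 - PowerSeries.X ^ 2) * weightSeries
          (fun p : ℕ × ℕ × ℕ × Unit => 2 * p.1 + (3 * p.2.1 + (4 * p.2.2.1 + 3))))) := by
      rw [weightSeries]; ring
    _ = PowerSeries.X ^ 3 := by
      rw [one_sub_X_pow_mul_weightSeries (by norm_num) h₂,
        one_sub_X_pow_mul_weightSeries (by norm_num) h₁,
        one_sub_X_pow_mul_weightSeries (by norm_num) h₀, weightSeries_const_unit]
end

section
/- For every positive integer n, the number of triangles with integer sides and perimeter n equals the number of partitions of n − 3 into parts taken from {2, 3, 4}; that is, it equals the number of triples (a, b, t) of nonnegative integers with 4a + 2b + 3t = n − 3 (and it is 0 when n < 3). -/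
theorem triangle_count_eq_partitions_into_2_3_4 (n : ℕ) (hn : 0 < n) :
    Nat.card {p : ℕ × ℕ × ℕ //
        0 < p.2.2 ∧ p.2.2 ≤ p.2.1 ∧ p.2.1 ≤ p.1 ∧
        p.1 + p.2.1 + p.2.2 = n ∧ p.1 < p.2.1 + p.2.2}
      = Nat.card {q : ℕ × ℕ × ℕ //
          (4 * q.1 + 2 * q.2.1 + 3 * q.2.2 : ℤ) = (n : ℤ) - 3} := by
  refine Nat.card_congr
    { toFun := fun p => ⟨(p.1.1 - p.1.2.1, p.1.2.1 - p.1.2.2, p.1.2.1 + p.1.2.2 - p.1.1 - 1), ?_⟩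
      invFun := fun q => ⟨(2 * q.1.1 + q.1.2.1 + q.1.2.2 + 1, q.1.1 + q.1.2.1 + q.1.2.2 + 1,
        q.1.1 + q.1.2.2 + 1), ?_⟩
      left_inv := ?_
      right_inv := ?_ }
  · obtain ⟨⟨x, y, z⟩, h⟩ := p
    dsimp only at h ⊢
    omega
  · obtain ⟨⟨a, b, t⟩, h⟩ := q
    dsimp only at h ⊢
    omega
  · rintro ⟨⟨x, y, z⟩, h⟩
    simp only [Subtype.mk.injEq, Prod.mk.injEq]
    dsimp only at h
    omega
  · rintro ⟨⟨a, b, t⟩, h⟩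
    simp only [Subtype.mk.injEq, Prod.mk.injEq]
    omega
end

section
/- The counting function T(n) of triangles with integer sides and perimeter n is a quasi-polynomial of period 12 and degree 2: for each residue r with 0 ≤ r < 12 there exists a polynomial p_r ∈ ℚ[X] of degree at most 2 such that T(n) = p_r(n) for all nonnegative integers n ≡ r (mod 12). -/
/-- The triples `x ≥ y ≥ z` of side lengths of the integer triangles of perimeter `n`. -/
abbrev IntegerTriangle (n : ℕ) : Type :=
  {t : ℕ × ℕ × ℕ //
    0 < t.2.2 ∧ t.2.2 ≤ t.2.1 ∧ t.2.1 ≤ t.1 ∧ t.1 + t.2.1 + t.2.2 = n ∧ t.1 < t.2.1 + t.2.2}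

namespace IntegerTriangle

/-- A triangle of given perimeter is determined by its two longest sides. -/
def equivSigma (n : ℕ) :
    IntegerTriangle n ≃
      (Finset.Ico ((n + 2) / 3) ((n + 1) / 2)).sigma fun x => Finset.Icc ((n - x + 1) / 2) x where
  toFun t := ⟨⟨t.1.1, t.1.2.1⟩, by
    obtain ⟨⟨x, y, z⟩, h⟩ := t
    simp only [Finset.mem_sigma, Finset.mem_Ico, Finset.mem_Icc] at h ⊢
    omega⟩
  invFun s := ⟨(s.1.1, s.1.2, n - s.1.1 - s.1.2), by
    obtain ⟨⟨x, y⟩, h⟩ := s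
    simp only [Finset.mem_sigma, Finset.mem_Ico, Finset.mem_Icc] at h ⊢
    omega⟩
  left_inv t := by
    obtain ⟨⟨x, y, z⟩, h⟩ := t
    simp only [Subtype.mk.injEq, Prod.mk.injEq, true_and] at h ⊢
    omega
  right_inv _ := rfl

theorem card_eq_sum (n : ℕ) :
    Nat.card (IntegerTriangle n) =
      ∑ x ∈ Finset.Ico ((n + 2) / 3) ((n + 1) / 2), (x + 1 - (n - x + 1) / 2) := by
  rw [Nat.card_congr (equivSigma n), Nat.card_eq_fintype_card, Fintype.card_coe,
    Finset.card_sigma]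
  simp only [Nat.card_Icc]

theorem card_add_twelve (n : ℕ) :
    Nat.card (IntegerTriangle (n + 12)) + n =
      Nat.card (IntegerTriangle n) + 3 * ((n + 1) / 2) + 3 := by
  rw [card_eq_sum, card_eq_sum, show (n + 12 + 2) / 3 = (n + 2) / 3 + 4 by omega,
    show (n + 12 + 1) / 2 = (n + 1) / 2 + 4 + 1 + 1 by omega,
    Finset.sum_Ico_succ_top (by omega), Finset.sum_Ico_succ_top (by omega),
    ← Finset.sum_Ico_add']
  have shift : ∀ x ∈ Finset.Ico ((n + 2) / 3) ((n + 1) / 2),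
      x + 4 + 1 - (n + 12 - (x + 4) + 1) / 2 = x + 1 - (n - x + 1) / 2 := by
    intro x hx
    rw [Finset.mem_Ico] at hx
    omega
  rw [Finset.sum_congr rfl shift]
  omega

theorem card_add_mul_twelve (r k : ℕ) :
    (Nat.card (IntegerTriangle (r + 12 * k)) : ℚ) =
      Nat.card (IntegerTriangle r) +
        ((r + 12 * k + 3 * (r % 2 : ℕ)) ^ 2 - (r + 3 * (r % 2 : ℕ)) ^ 2) / 48 := by
  induction k with
  | zero => simp
  | succ k ih =>
    have step : 2 * Nat.card (IntegerTriangle (r + 12 * (k + 1))) =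
        2 * Nat.card (IntegerTriangle (r + 12 * k)) + (r + 12 * k) + 3 * (r % 2) + 6 := by
      have h := card_add_twelve (r + 12 * k)
      rw [show r + 12 * k + 12 = r + 12 * (k + 1) by ring] at h
      omega
    have step' := congrArg (Nat.cast : ℕ → ℚ) step
    simp only [Nat.cast_add, Nat.cast_mul, Nat.cast_ofNat, Nat.cast_one] at step' ⊢
    linear_combination ih + step' / 2

end IntegerTriangle

theorem triangle_count_is_quasipolynomial :
    ∀ r < 12, ∃ p : Polynomial ℚ, p.degree ≤ 2 ∧
      ∀ n : ℕ, n % 12 = r →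
        (Nat.card {t : ℕ × ℕ × ℕ //
            0 < t.2.2 ∧ t.2.2 ≤ t.2.1 ∧ t.2.1 ≤ t.1 ∧
            t.1 + t.2.1 + t.2.2 = n ∧ t.1 < t.2.1 + t.2.2} : ℚ)
          = p.eval (n : ℚ) := by
  intro r _
  open Polynomial in
  refine ⟨C (1 / 48) * (X + C (3 * (r % 2 : ℕ) : ℚ)) ^ 2 +
    C (Nat.card (IntegerTriangle r) - (r + 3 * (r % 2 : ℕ)) ^ 2 / 48 : ℚ), by compute_degree, ?_⟩
  intro n hn
  obtain ⟨k, rfl⟩ : ∃ k, n = r + 12 * k := ⟨n / 12, by omega⟩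
  refine (IntegerTriangle.card_add_mul_twelve r k).trans ?_
  simp only [Polynomial.eval_add, Polynomial.eval_mul, Polynomial.eval_pow, Polynomial.eval_C,
    Polynomial.eval_X, Nat.cast_add, Nat.cast_mul, Nat.cast_ofNat]
  ring
end
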